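/- There exist a subset (semigroup) S of the free group F₂ and an S-admissible weight ω on F₂ such that ℓ^p(F₂,ω) contains an S-dense vector, but the sufficient condition 'for every finite K ⊂ F₂, inf_{s∈S} max over sK ∪ s⁻¹K of ω equals 0' fails. -/

import Mathlib

open ENNReal

noncomputable section

variable {G : Type*}

/-- Weighted `ℓ^p` norm on a discrete group (counting measure). -/
def wNormD (p : ℝ) (ω : G → ℝ) (f : G → ℂ) : ℝ≥0∞ :=
  (∑' t, (‖f t‖₊ * ENNReal.ofReal (ω t)) ^ p) ^ (1 / p)

/-- Left translation operator `(T_s f)(t) = f(s⁻¹ t)`. -/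
def transl [Group G] (s : G) (f : G → ℂ) : G → ℂ := fun t => f (s⁻¹ * t)

/-- The translation `T_s` is a bounded operator on `ℓ^p(G,ω)`. -/
def BoundedTranslD [Group G] (p : ℝ) (ω : G → ℝ) (s : G) : Prop :=
  ∃ C : ℝ≥0∞, C < ⊤ ∧ ∀ f : G → ℂ, wNormD p ω (transl s f) ≤ C * wNormD p ω f

/-- `x` is an `S`-dense vector in `ℓ^p(G,ω)`: its `S`-orbit is dense. -/
def SDenseVecD [Group G] (p : ℝ) (ω : G → ℝ) (S : Set G) (x : G → ℂ) : Prop :=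
  wNormD p ω x < ⊤ ∧
    ∀ g : G → ℂ, wNormD p ω g < ⊤ → ∀ ε : ℝ, 0 < ε →
      ∃ s ∈ S, wNormD p ω (fun t => transl s x t - g t) < ENNReal.ofReal ε


open FreeGroup Filter Topology

/-- The number of positive letters in the reduced word of `g`. -/
def posCount {α : Type*} [DecidableEq α] (g : FreeGroup α) : ℕ :=
  g.toWord.countP (fun l => l.2)

lemma inv_of_pow_succ_mul {α : Type*} (x : α) (n : ℕ) (g : FreeGroup α) :
    (of x ^ (n + 1))⁻¹ * g = (of x)⁻¹ * ((of x ^ n)⁻¹ * g) := by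
  rw [pow_succ]; group

section PosCount

variable {α : Type*} [DecidableEq α]

lemma posCount_mul_le (g h : FreeGroup α) : posCount (g * h) ≤ posCount g + posCount h := by
  unfold posCount
  rw [← List.countP_append]
  exact (toWord_mul_sublist g h).countP_le

lemma posCount_le_norm (g : FreeGroup α) : posCount g ≤ g.norm :=
  List.countP_le_length

lemma posCount_inv_of_pow (x : α) (n : ℕ) : posCount ((of x ^ n)⁻¹) = 0 := by
  simp [posCount, toWord_inv, invRev]

lemma toWord_of_mul {x : α} {g : FreeGroup α} (h : g ∉ startsWith (x, false)) :
    (of x * g).toWord = (x, true) :: g.toWord := by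
  rw [toWord_mul, toWord_of, List.singleton_append, reduce.cons, reduce_toWord]
  rcases hg : g.toWord with _ | ⟨⟨y, c⟩, l⟩
  · rfl
  · have : ¬ (x = y ∧ c = false) := by
      rintro ⟨rfl, rfl⟩
      exact h (by simp [startsWith, hg])
    have h' : ¬ (x = y ∧ true = !c) := by
      rintro ⟨rfl, hc⟩
      cases c <;> simp_all
    exact if_neg h'

lemma of_pow_mul_notMem {x : α} {g : FreeGroup α} (h : g ∉ startsWith (x, false)) (n : ℕ) :
    of x ^ n * g ∉ startsWith (x, false) ∧ posCount (of x ^ n * g) = n + posCount g := by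
  induction n with
  | zero => simpa using h
  | succ n ih =>
    have hw := toWord_of_mul ih.1
    rw [← mul_assoc, ← pow_succ'] at hw
    refine ⟨by simp [startsWith, hw], ?_⟩
    have := ih.2
    unfold posCount at this ⊢
    rw [hw, List.countP_cons, this]
    simp
    ring

lemma inv_of_mul_mem {x : α} {g : FreeGroup α} (h : g ∉ startsWith (x, true)) :
    (of x)⁻¹ * g ∈ startsWith (x, false) := by
  have : (of x)⁻¹ = mk [(x, false)] := rfl
  rw [this]
  exact startsWith_mk_mul g (by simpa using h)

lemma notMem_startsWith {w w' : α × Bool} {g : FreeGroup α} (h : w ≠ w')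
    (hg : g ∈ startsWith w) : g ∉ startsWith w' :=
  (startsWith.disjoint_iff_ne.mpr h).notMem_of_mem_left hg

lemma inv_of_pow_mul_mem_of_posCount_lt {x : α} {g : FreeGroup α} {n : ℕ}
    (h : posCount g < n) : (of x ^ n)⁻¹ * g ∈ startsWith (x, false) := by
  obtain ⟨n, rfl⟩ : ∃ k, n = k + 1 := ⟨n - 1, by omega⟩
  rw [inv_of_pow_succ_mul]
  refine inv_of_mul_mem fun hmem => ?_
  set k := (of x ^ n)⁻¹ * g with hk
  have hg : g = of x ^ n * k := by rw [hk]; group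
  have h2 := (of_pow_mul_notMem (notMem_startsWith (w' := (x, false)) (by simp) hmem) n).2
  have h3 : 0 < posCount k := by
    obtain ⟨l, hl⟩ : ∃ l, k.toWord = (x, true) :: l := by
      rcases hw : k.toWord with _ | ⟨y, l⟩
      · simp [startsWith, hw] at hmem
      · have : y = (x, true) := by simpa [startsWith, hw] using hmem
        exact ⟨l, by rw [this]⟩
    simp [posCount, hl]
  rw [← hg] at h2
  omega

lemma inv_of_pow_succ_mul_mem {x : α} {g : FreeGroup α} (h : g ∉ startsWith (x, true)) (n : ℕ) :
    (of x ^ (n + 1))⁻¹ * g ∈ startsWith (x, false) := by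
  induction n with
  | zero => simpa using inv_of_mul_mem h
  | succ n ih =>
    rw [inv_of_pow_succ_mul]
    exact inv_of_mul_mem (notMem_startsWith (by simp) ih)

lemma eq_of_inv_of_pow_mul_eq {x y : α} (hxy : x ≠ y) {g h : FreeGroup α}
    (hg : g ∈ startsWith (x, false)) (hh : h ∈ startsWith (x, false)) {m n : ℕ}
    (e : (of y ^ m)⁻¹ * g = (of y ^ n)⁻¹ * h) : m = n := by
  wlog hmn : m < n generalizing m n g h
  · rcases lt_trichotomy m n with hlt | heq | hgt
    · exact absurd hlt hmn
    · exact heq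
    · exact (this hh hg e.symm hgt).symm
  obtain ⟨k, rfl⟩ : ∃ k, n = m + (k + 1) := ⟨n - m - 1, by omega⟩
  have e' : g = (of y ^ (k + 1))⁻¹ * h := by
    rw [pow_add (of y) m, mul_inv_rev] at e
    have : (of y ^ m)⁻¹ * g = (of y ^ m)⁻¹ * ((of y ^ (k + 1))⁻¹ * h) := by
      rw [e, ← mul_assoc, ← mul_inv_rev, ← mul_inv_rev, ← pow_add, ← pow_add, add_comm m]
    exact mul_left_cancel this
  have h1 : g ∈ startsWith (y, false) := by
    rw [e']
    exact inv_of_pow_succ_mul_mem (notMem_startsWith (by simp) hh) k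
  exact absurd h1 (notMem_startsWith (by simp [hxy]) hg)

end PosCount

/-- The semigroup of positive words of `F₂`. -/
def positiveWords : Set (FreeGroup Bool) := {q | posCount q⁻¹ = 0}

lemma one_mem_positiveWords : (1 : FreeGroup Bool) ∈ positiveWords := by
  simp [positiveWords, posCount]

lemma mul_mem_positiveWords {q r : FreeGroup Bool} (hq : q ∈ positiveWords)
    (hr : r ∈ positiveWords) : q * r ∈ positiveWords := by
  have := posCount_mul_le r⁻¹ q⁻¹
  simp only [positiveWords, Set.mem_ofPred_eq, mul_inv_rev] at *
  omega

/-- The word distance from `t` to its translates by positive words on the right. -/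
def depth (t : FreeGroup Bool) : ℕ := ⨅ q : positiveWords, (t * (q : FreeGroup Bool)⁻¹).norm

instance : Nonempty positiveWords := ⟨⟨1, one_mem_positiveWords⟩⟩

lemma depth_le {q : FreeGroup Bool} (hq : q ∈ positiveWords) (t : FreeGroup Bool) :
    depth t ≤ (t * q⁻¹).norm :=
  ciInf_le' (fun q : positiveWords => (t * (q : FreeGroup Bool)⁻¹).norm) ⟨q, hq⟩

lemma exists_depth_eq (t : FreeGroup Bool) : ∃ q ∈ positiveWords, depth t = (t * q⁻¹).norm := by
  obtain ⟨q, hq⟩ := ciInf_mem fun q : positiveWords => (t * (q : FreeGroup Bool)⁻¹).norm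
  exact ⟨q, q.2, hq.symm⟩

lemma depth_eq_zero {q : FreeGroup Bool} (hq : q ∈ positiveWords) : depth q = 0 := by
  simpa using depth_le hq q

lemma depth_le_depth_mul_add (s t : FreeGroup Bool) : depth t ≤ depth (s * t) + s.norm := by
  obtain ⟨q, hq, h⟩ := exists_depth_eq (s * t)
  have h1 := FreeGroup.norm_mul_le s⁻¹ (s * t * q⁻¹)
  rw [norm_inv_eq, show s⁻¹ * (s * t * q⁻¹) = t * q⁻¹ by group] at h1
  have := depth_le hq t
  omega

/-- The positive words `a ^ N * b ^ n` along which the dense orbit is built. -/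
def blockWord (N n : ℕ) : FreeGroup Bool := of true ^ N * of false ^ n

lemma blockWord_mem (N n : ℕ) : blockWord N n ∈ positiveWords :=
  mul_mem_positiveWords (posCount_inv_of_pow _ _) (posCount_inv_of_pow _ _)

lemma norm_blockWord_le (N n : ℕ) : (blockWord N n).norm ≤ N + n := by
  simpa [blockWord] using FreeGroup.norm_mul_le (of true ^ N) (of false ^ n : FreeGroup Bool)

lemma le_posCount_blockWord (N n : ℕ) : N ≤ posCount (blockWord N n) := by
  have h : (of false ^ n : FreeGroup Bool) ∉ startsWith (true, false) := by
    intro h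
    have := List.mem_of_getElem? h
    simp at this
  rw [blockWord, (of_pow_mul_notMem h N).2]
  omega

lemma eq_of_inv_blockWord_mul_eq {N M n m : ℕ} {u v : FreeGroup Bool} (hu : posCount u < N)
    (hv : posCount v < M) (h : (blockWord N n)⁻¹ * u = (blockWord M m)⁻¹ * v) : n = m := by
  simp only [blockWord, mul_inv_rev, mul_assoc] at h
  exact eq_of_inv_of_pow_mul_eq (by simp) (inv_of_pow_mul_mem_of_posCount_lt hu)
    (inv_of_pow_mul_mem_of_posCount_lt hv) h

lemma posCount_mul_inv_le (k : FreeGroup Bool) {q : FreeGroup Bool} (hq : q ∈ positiveWords) :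
    posCount (k * q⁻¹) ≤ k.norm := by
  have h1 := posCount_mul_le k q⁻¹
  have h2 := posCount_le_norm k
  have h3 : posCount q⁻¹ = 0 := hq
  omega

lemma le_depth_blockWord_mul {N M n m : ℕ} (hnm : n ≠ m) {k : FreeGroup Bool} (hk : k.norm < N) :
    M ≤ depth (blockWord M m * ((blockWord N n)⁻¹ * k)) := by
  obtain ⟨q, hq, h⟩ := exists_depth_eq (blockWord M m * ((blockWord N n)⁻¹ * k))
  rw [h]
  by_contra! hlt
  refine hnm (eq_of_inv_blockWord_mul_eq ((posCount_mul_inv_le k hq).trans_lt hk)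
    ((posCount_le_norm _).trans_lt hlt) ?_)
  group

lemma le_depth_inv_blockWord_mul (N n : ℕ) (k : FreeGroup Bool) :
    N ≤ depth ((blockWord N n)⁻¹ * k) + k.norm := by
  obtain ⟨q, hq, h⟩ := exists_depth_eq ((blockWord N n)⁻¹ * k)
  have h1 := posCount_mul_le (k * q⁻¹) ((blockWord N n)⁻¹ * k * q⁻¹)⁻¹
  rw [show k * q⁻¹ * ((blockWord N n)⁻¹ * k * q⁻¹)⁻¹ = blockWord N n by group] at h1
  have h2 := posCount_le_norm ((blockWord N n)⁻¹ * k * q⁻¹)⁻¹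
  rw [norm_inv_eq] at h2
  have h3 := posCount_mul_inv_le k hq
  have h4 := le_posCount_blockWord N n
  omega

/-- The weight `2 ^ (-depth)`. -/
def depthWeight (t : FreeGroup Bool) : ℝ := (1 / 2) ^ depth t

lemma depthWeight_pos (t : FreeGroup Bool) : 0 < depthWeight t := by
  unfold depthWeight; positivity

lemma ofReal_depthWeight (t : FreeGroup Bool) :
    ENNReal.ofReal (depthWeight t) = 2⁻¹ ^ depth t := by
  rw [depthWeight, ENNReal.ofReal_pow (by norm_num), one_div, ENNReal.ofReal_inv_of_pos (by norm_num)]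
  simp

/-- The `p`-th power of the weighted `ℓ^p` norm. -/
def energy (p : ℝ) (ω : G → ℝ) (f : G → ℂ) : ℝ≥0∞ :=
  ∑' t, (‖f t‖₊ * ENNReal.ofReal (ω t)) ^ p

lemma wNormD_lt_iff {p : ℝ} (hp : 0 < p) (ω : G → ℝ) (f : G → ℂ) (c : ℝ≥0∞) :
    wNormD p ω f < c ↔ energy p ω f < c ^ p := by
  rw [wNormD, one_div, ENNReal.rpow_inv_lt_iff hp, energy]

lemma energy_transl [Group G] (p : ℝ) (ω : G → ℝ) (s : G) (f : G → ℂ) :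
    energy p ω (transl s f) = ∑' u, (‖f u‖₊ * ENNReal.ofReal (ω (s * u))) ^ p := by
  rw [energy, ← (Equiv.mulLeft s).tsum_eq]
  simp [transl]

lemma energy_add_le {p : ℝ} (hp : 1 ≤ p) (ω : G → ℝ) (f g : G → ℂ) :
    energy p ω (fun t => f t + g t) ≤ 2 ^ (p - 1) * (energy p ω f + energy p ω g) := by
  unfold energy
  rw [← ENNReal.tsum_add, ← ENNReal.tsum_mul_left]
  refine ENNReal.tsum_le_tsum fun t => ?_
  refine le_trans ?_ (ENNReal.rpow_add_le_mul_rpow_add_rpow _ _ hp)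
  rw [← add_mul]
  gcongr
  exact_mod_cast nnnorm_add_le (f t) (g t)

lemma boundedTranslD_depthWeight {p : ℝ} (hp : 0 < p) (s : FreeGroup Bool) :
    BoundedTranslD p depthWeight s := by
  refine ⟨2 ^ s.norm, by finiteness, fun f => ?_⟩
  have key : energy p depthWeight (transl s f) ≤
      (2 ^ s.norm) ^ p * energy p depthWeight f := by
    rw [energy_transl, energy, ← ENNReal.tsum_mul_left]
    refine ENNReal.tsum_le_tsum fun t => ?_
    rw [← ENNReal.mul_rpow_of_nonneg _ _ hp.le, mul_left_comm]
    gcongr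
    rw [ofReal_depthWeight, ofReal_depthWeight]
    calc (2⁻¹ : ℝ≥0∞) ^ depth (s * t)
        = 2 ^ s.norm * 2⁻¹ ^ (depth (s * t) + s.norm) := by
          rw [pow_add, mul_left_comm, ← mul_pow, ENNReal.mul_inv_cancel (by simp) (by simp)]
          simp
      _ ≤ 2 ^ s.norm * 2⁻¹ ^ depth t := by
          gcongr 2 ^ s.norm * ?_
          exact pow_le_pow_right_of_le_one' (by simp) (depth_le_depth_mul_add s t)
  calc wNormD p depthWeight (transl s f)
      ≤ ((2 ^ s.norm) ^ p * energy p depthWeight f) ^ (1 / p) := by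
        unfold wNormD
        gcongr
        exact key
    _ = 2 ^ s.norm * wNormD p depthWeight f := by
        rw [ENNReal.mul_rpow_of_nonneg _ _ (by positivity), ← ENNReal.rpow_mul,
          mul_one_div_cancel hp.ne', ENNReal.rpow_one]
        rfl

/-- Translates of a vector supported where the weight is deep have small energy. -/
lemma tsum_translate_le {p : ℝ} (hp : 1 ≤ p) {f : FreeGroup Bool → ℂ} {L e : ℕ}
    {τ s : FreeGroup Bool} (hL : ∑' k, (‖f k‖₊ : ℝ≥0∞) ^ p ≤ 2 ^ L)
    (h : ∀ k, f k ≠ 0 → L + e ≤ depth (τ * (s⁻¹ * k))) :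
    ∑' u, (‖f (s * u)‖₊ * ENNReal.ofReal (depthWeight (τ * u))) ^ p ≤ 2⁻¹ ^ e := by
  have hp0 : 0 < p := by linarith
  rw [← (Equiv.mulLeft s⁻¹).tsum_eq]
  calc _ ≤ ∑' k, (‖f k‖₊ : ℝ≥0∞) ^ p * 2⁻¹ ^ (L + e) := by
        refine ENNReal.tsum_le_tsum fun k => ?_
        simp only [Equiv.coe_mulLeft, mul_inv_cancel_left]
        by_cases hk : f k = 0
        · simp [hk, hp0]
        rw [ENNReal.mul_rpow_of_nonneg _ _ hp0.le, ofReal_depthWeight]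
        gcongr
        calc ((2⁻¹ : ℝ≥0∞) ^ depth (τ * (s⁻¹ * k))) ^ p
            ≤ (2⁻¹ ^ depth (τ * (s⁻¹ * k))) ^ (1 : ℝ) :=
              ENNReal.rpow_le_rpow_of_exponent_ge (pow_le_one' (by simp) _) hp
          _ ≤ 2⁻¹ ^ (L + e) := by
              rw [ENNReal.rpow_one]
              exact pow_le_pow_right_of_le_one' (by simp) (h k hk)
    _ ≤ 2 ^ L * 2⁻¹ ^ (L + e) := by
        rw [ENNReal.tsum_mul_right]
        gcongr
    _ = 2⁻¹ ^ e := by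
        rw [pow_add, ← mul_assoc, ← mul_pow, ENNReal.mul_inv_cancel (by simp) (by simp)]
        simp

lemma tsum_eq_or_eq_zero {F : ℕ → ℂ} (hF : ∀ m n, F m ≠ 0 → F n ≠ 0 → m = n) :
    ∑' n, F n = 0 ∨ ∃ n, ∑' n, F n = F n := by
  by_cases h : ∃ n, F n ≠ 0
  · obtain ⟨n, hn⟩ := h
    exact Or.inr ⟨n, tsum_eq_single n fun m hm => by_contra fun h => hm (hF m n h hn)⟩
  · push Not at h
    simp [h]

/-- The energy of a disjoint superposition is at most the sum of the energies. -/
lemma tsum_rpow_tsum_le {p : ℝ} (hp : 0 < p) {F : ℕ → G → ℂ}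
    (hF : ∀ u m n, F m u ≠ 0 → F n u ≠ 0 → m = n) (w : G → ℝ≥0∞) :
    ∑' u, (‖∑' n, F n u‖₊ * w u) ^ p ≤ ∑' n, ∑' u, (‖F n u‖₊ * w u) ^ p := by
  rw [ENNReal.tsum_comm]
  refine ENNReal.tsum_le_tsum fun u => ?_
  rcases tsum_eq_or_eq_zero (hF u) with h | ⟨n, h⟩
  · simp [h, hp]
  · rw [h]
    exact ENNReal.le_tsum (f := fun n => (‖F n u‖₊ * w u) ^ p) n

lemma tsum_sub_eq_tsum_ite {F : ℕ → ℂ} (hF : ∀ m n, F m ≠ 0 → F n ≠ 0 → m = n) (m : ℕ) :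
    ∑' n, F n - F m = ∑' n, if n = m then 0 else F n := by
  by_cases h : ∃ n, F n ≠ 0
  · obtain ⟨n, hn⟩ := h
    have h0 : ∀ k, k ≠ n → F k = 0 := fun k hk => by_contra fun h => hk (hF k n h hn)
    rw [tsum_eq_single n h0, tsum_eq_single n fun k hk => by simp [h0 k hk]]
    by_cases hnm : n = m
    · simp [hnm]
    · simp [hnm, h0 m (Ne.symm hnm)]
  · push Not at h
    simp [h]

lemma exists_blocks {p : ℝ} (hp : 1 ≤ p) (g : ℕ → FreeGroup Bool →₀ ℂ) :
    ∃ x : FreeGroup Bool → ℂ, energy p depthWeight x < ⊤ ∧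
      ∀ m, ∃ s ∈ positiveWords,
        energy p depthWeight (fun t => transl s x t - g m t) ≤ 2 * 2⁻¹ ^ m := by
  have hp0 : 0 < p := by linarith
  have hLex : ∀ n, ∃ L : ℕ, ∑' k, (‖g n k‖₊ : ℝ≥0∞) ^ p ≤ 2 ^ L := by
    intro n
    have hfin : ∑' k, (‖g n k‖₊ : ℝ≥0∞) ^ p < ⊤ := by
      rw [tsum_eq_sum (s := (g n).support) (fun k hk => by simp_all)]
      refine ENNReal.sum_lt_top.2 fun k _ => ?_
      finiteness
    obtain ⟨L, hL⟩ := ENNReal.exists_nat_gt hfin.ne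
    refine ⟨L, hL.le.trans ?_⟩
    exact_mod_cast Nat.lt_two_pow_self.le
  choose L hL using hLex
  let r : ℕ → ℕ := fun n => (g n).support.sup FreeGroup.norm
  have hr : ∀ n k, g n k ≠ 0 → k.norm ≤ r n := fun n k hk =>
    Finset.le_sup (f := FreeGroup.norm) (Finsupp.mem_support_iff.2 hk)
  let c : ℕ → ℕ := fun n => r n + L n + 3 * n + 1
  let N : ℕ → ℕ := fun n => ∑ i ∈ Finset.range (n + 1), c i
  have hcN : ∀ n, c n ≤ N n := fun n =>
    Finset.single_le_sum (f := c) (fun _ _ => Nat.zero_le _) (Finset.self_mem_range_succ n)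
  have hNN : ∀ m n, m < n → N m + c n ≤ N n := by
    intro m n hmn
    have : N n = ∑ i ∈ Finset.range n, c i + c n := Finset.sum_range_succ _ _
    rw [this]
    gcongr
    exact Finset.sum_le_sum_of_subset (Finset.range_mono hmn)
  let s : ℕ → FreeGroup Bool := fun n => blockWord (N n) n
  let F : ℕ → FreeGroup Bool → ℂ := fun n u => g n (s n * u)
  have hnorm : ∀ n k, g n k ≠ 0 → k.norm < N n := fun n k hk => by
    have h1 := hr n k hk
    have h2 := hcN n
    simp only [c] at h2
    omega
  have hF : ∀ u m n, F m u ≠ 0 → F n u ≠ 0 → m = n := fun u m n hm hn =>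
    eq_of_inv_blockWord_mul_eq ((posCount_le_norm _).trans_lt (hnorm m _ hm))
      ((posCount_le_norm _).trans_lt (hnorm n _ hn)) (by simp [s])
  refine ⟨fun u => ∑' n, F n u, ?_, fun m => ⟨s m, blockWord_mem _ _, ?_⟩⟩
  · calc energy p depthWeight (fun u => ∑' n, F n u)
        ≤ ∑' n, ∑' u, (‖F n u‖₊ * ENNReal.ofReal (depthWeight u)) ^ p := tsum_rpow_tsum_le hp0 hF _
      _ ≤ ∑' n : ℕ, 2⁻¹ ^ n := by
          refine ENNReal.tsum_le_tsum fun n => ?_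
          have := tsum_translate_le hp (τ := 1) (s := s n) (e := n) (hL n) fun k hk => by
            have h1 := le_depth_inv_blockWord_mul (N n) n k
            have h2 := hr n k hk
            have h3 := hcN n
            simp only [c, s, one_mul] at h3 ⊢
            omega
          simpa using this
      _ < ⊤ := by simp
  · have hsplit : (fun t => transl (s m) (fun u => ∑' n, F n u) t - g m t) =
        transl (s m) (fun u => ∑' n, if n = m then 0 else F n u) := by
      funext t
      simp only [transl]
      rw [← tsum_sub_eq_tsum_ite (hF _)]
      simp [F]
    rw [hsplit, energy_transl]
    calc _ ≤ ∑' n, ∑' u, (‖if n = m then 0 else F n u‖₊ *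
            ENNReal.ofReal (depthWeight (s m * u))) ^ p := by
          refine tsum_rpow_tsum_le hp0 (F := fun n u => if n = m then 0 else F n u) ?_ _
          intro u i j hi hj
          refine hF u i j ?_ ?_ <;> grind
      _ ≤ ∑' n : ℕ, 2⁻¹ ^ (n + m) := by
          refine ENNReal.tsum_le_tsum fun n => ?_
          rcases eq_or_ne n m with rfl | hnm
          · simp [hp0]
          simp only [if_neg hnm]
          refine tsum_translate_le hp (hL n) fun k hk => ?_
          rcases lt_or_gt_of_ne hnm with hlt | hgt
          · have h1 := le_depth_blockWord_mul (M := N m) (m := m) hnm (hnorm n k hk)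
            have h2 := hNN n m hlt
            have h3 := hcN n
            simp only [c, s] at h2 h3 ⊢
            omega
          · have h1 := le_depth_inv_blockWord_mul (N n) n k
            have h2 := depth_le_depth_mul_add (s m) ((s n)⁻¹ * k)
            have h3 := norm_blockWord_le (N m) m
            have h4 := hNN m n hgt
            have h5 := hr n k hk
            simp only [c, s] at h2 h4 ⊢
            omega
      _ = 2 * 2⁻¹ ^ m := by
          simp_rw [pow_add]
          rw [ENNReal.tsum_mul_right, ENNReal.tsum_geometric, ENNReal.one_sub_inv_two, inv_inv]

lemma exists_countable_dense_finsupp {p : ℝ} (hp : 0 < p) (ω : G → ℝ) [Countable G] :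
    ∃ g : ℕ → G →₀ ℂ, ∀ f : G → ℂ, energy p ω f < ⊤ → ∀ ε : ℝ≥0∞, 0 < ε →
      ∃ i, energy p ω (fun t => g i t - f t) < ε := by
  classical
  let D : ℕ → ℂ := fun n => n.casesOn 0 (TopologicalSpace.denseSeq ℂ)
  have hD : DenseRange D := (TopologicalSpace.denseRange_denseSeq ℂ).mono (by
    rintro _ ⟨n, rfl⟩
    exact ⟨n + 1, rfl⟩)
  obtain ⟨e, he⟩ := exists_surjective_nat (G →₀ ℕ)
  refine ⟨fun i => (e i).mapRange D rfl, fun f hf ε hε => ?_⟩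
  have hε2 : 0 < ε / 2 := ENNReal.half_pos hε.ne'
  obtain ⟨K, hK⟩ := (((tendsto_order.1 (ENNReal.tendsto_tsum_compl_atTop_zero hf.ne)).2 _ hε2)).exists
  obtain ⟨δ, hδ, hδsum⟩ := ENNReal.exists_pos_sum_of_countable' hε2.ne' G
  have hn : ∀ t, ∃ n, (‖D n - f t‖₊ * ENNReal.ofReal (ω t)) ^ p < δ t := by
    intro t
    have hc : Continuous fun z : ℂ => ((‖z - f t‖₊ : ℝ≥0∞) * ENNReal.ofReal (ω t)) ^ p := by
      refine ENNReal.continuous_rpow_const.comp ?_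
      refine (ENNReal.continuous_mul_const ENNReal.ofReal_ne_top).comp ?_
      fun_prop
    obtain ⟨n, hn⟩ := hD.exists_mem_open (isOpen_Iio.preimage hc) ⟨f t, by simpa [hp] using hδ t⟩
    exact ⟨n, hn⟩
  choose n hn using hn
  obtain ⟨i, hi⟩ := he (Finsupp.onFinset K (fun t => if t ∈ K then n t else 0) (by simp_all))
  refine ⟨i, ?_⟩
  calc energy p ω (fun t => (e i).mapRange D rfl t - f t)
      ≤ ∑' t, (δ t + Set.indicator {t | t ∉ K}
          (fun t => (‖f t‖₊ * ENNReal.ofReal (ω t)) ^ p) t) := by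
        refine ENNReal.tsum_le_tsum fun t => ?_
        rw [hi]
        by_cases ht : t ∈ K
        · simpa [ht] using (hn t).le
        · simp [ht, D]
    _ = ∑' t, δ t + ∑' t : {t // t ∉ K}, (‖f t‖₊ * ENNReal.ofReal (ω t)) ^ p := by
        rw [ENNReal.tsum_add, ← tsum_subtype]
        rfl
    _ < ε / 2 + ε / 2 := ENNReal.add_lt_add hδsum hK
    _ = ε := ENNReal.add_halves ε

lemma exists_sDenseVecD {p : ℝ} (hp : 1 ≤ p) :
    ∃ x, SDenseVecD p depthWeight positiveWords x := by
  have hp0 : 0 < p := by linarith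
  obtain ⟨g, hg⟩ := exists_countable_dense_finsupp hp0 depthWeight
  obtain ⟨x, hx, hxg⟩ := exists_blocks hp fun m => g m.unpair.1
  refine ⟨x, by simpa [wNormD_lt_iff hp0, hp0] using hx, fun f hf ε hε => ?_⟩
  set η : ℝ≥0∞ := ENNReal.ofReal ε ^ p / 2 ^ (p - 1) / 2 with hη
  have hη0 : 0 < η := by
    refine ENNReal.half_pos (ENNReal.div_pos ?_ (by finiteness)).ne'
    exact (ENNReal.rpow_pos (by simpa using hε) (by simp)).ne'
  obtain ⟨i, hi⟩ := hg f (by simpa [wNormD_lt_iff hp0, hp0] using hf) η hη0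
  have hlim : Tendsto (fun m : ℕ => (2 : ℝ≥0∞) * 2⁻¹ ^ m) atTop (𝓝 (2 * 0)) :=
    ENNReal.Tendsto.const_mul (ENNReal.tendsto_pow_atTop_nhds_zero_of_lt_one (by simp)) (by simp)
  rw [mul_zero] at hlim
  obtain ⟨j, hj⟩ := eventually_atTop.1 ((tendsto_order.1 hlim).2 η hη0)
  obtain ⟨s, hs, hsm⟩ := hxg (Nat.pair i j)
  refine ⟨s, hs, (wNormD_lt_iff hp0 _ _ _).2 ?_⟩
  rw [Nat.unpair_pair] at hsm
  have hsum := energy_add_le hp depthWeight (fun t => transl s x t - g i t) (fun t => g i t - f t)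
  simp only [sub_add_sub_cancel] at hsum
  refine hsum.trans_lt (ENNReal.mul_lt_of_lt_div' ?_)
  rw [← ENNReal.add_halves (ENNReal.ofReal ε ^ p / 2 ^ (p - 1))]
  exact ENNReal.add_lt_add (hsm.trans_lt (hj _ (Nat.right_le_pair i j))) hi

open Pointwise in
/-- There exist a subsemigroup `S` of `F₂` and an `S`-admissible weight `ω` such that
`ℓ^p(F₂,ω)` contains an `S`-dense vector, but the sufficient condition
`inf_{s ∈ S} sup_{sK ∪ s⁻¹K} ω = 0` (for every finite `K`) fails. -/
theorem stmt14 (p : ℝ) (hp : 1 ≤ p) :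
    ∃ S : Set (FreeGroup Bool), ∃ ω : FreeGroup Bool → ℝ,
      (∀ x ∈ S, ∀ y ∈ S, x * y ∈ S) ∧
      (∀ t, 0 < ω t) ∧
      (∀ s ∈ S, BoundedTranslD p ω s) ∧
      (∃ x : FreeGroup Bool → ℂ, SDenseVecD p ω S x) ∧
      ¬ (∀ K : Finset (FreeGroup Bool), ∀ ε : ℝ, 0 < ε →
          ∃ s ∈ S, ∀ t ∈ s • (K : Set (FreeGroup Bool)) ∪ s⁻¹ • (K : Set (FreeGroup Bool)),
            ω t < ε) := by
  have hp0 : 0 < p := by linarith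
  refine ⟨positiveWords, depthWeight, fun x hx y hy => mul_mem_positiveWords hx hy,
    depthWeight_pos, fun s _ => boundedTranslD_depthWeight hp0 s, exists_sDenseVecD hp, fun h => ?_⟩
  obtain ⟨s, hs, h⟩ := h {1} 1 one_pos
  have := h s (Or.inl (by simp))
  simp [depthWeight, depth_eq_zero hs] at this
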